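/- Let M be an (n−k) × 2n matrix over a finite field F_q with linearly independent rows whose row space is an isotropic subspace of F_q^{2n} with respect to the symplectic form. Then there exists an admissible (n−k)-subset S of J such that the columns of M indexed by S are linearly independent; consequently the symplectic matroid represented by M has rank n−k. -/

import Mathlib

open Matrix Finset

abbrev J (n : ℕ) := Fin n ⊕ Fin n

/-- The involution `i ↔ i*` on `J n = [n] ∪ [n]*`. -/
def starJ {n : ℕ} : J n → J n := Sum.swap

/-- A subset `S ⊆ J` is admissible if `S ∩ S* = ∅`. -/
def Admissible {n : ℕ} (S : Finset (J n)) : Prop := ∀ x ∈ S, starJ x ∉ S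

/-- Rank function realizing the standard order `n > ... > 1 > 1* > ... > n*` on `J n`. -/
def stdRank {n : ℕ} : J n → ℤ
  | Sum.inl i => (i : ℤ) + 1
  | Sum.inr i => -((i : ℤ) + 1)

/-- A permutation of `J` is admissible if it commutes with the involution. -/
def IsAdmissiblePerm {n : ℕ} (w : Equiv.Perm (J n)) : Prop :=
  ∀ x, w (starJ x) = starJ (w x)

/-- The key function inducing the order `≤^w`: `i ≤^w j ↔ keyFun w i ≤ keyFun w j`. -/
def keyFun {n : ℕ} (w : Equiv.Perm (J n)) : J n → ℤ := fun x => stdRank (w.symm x)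

/-- `A ≤^w B` : listing `A` and `B` in increasing `≤^w` order as `a_1, ..., a_k` and
`b_1, ..., b_k`, we have `a_i ≤^w b_i` for all `i`.  (Implemented by comparing the
images of `A` and `B` under the order embedding `keyFun w : J n → ℤ`.) -/
def GaleLE {n : ℕ} (w : Equiv.Perm (J n)) (A B : Finset (J n)) : Prop :=
  ∃ (k : ℕ) (hA : (A.image (keyFun w)).card = k) (hB : (B.image (keyFun w)).card = k),
    ∀ i : Fin k, ((A.image (keyFun w)).orderIsoOfFin hA i : ℤ) ≤
      ((B.image (keyFun w)).orderIsoOfFin hB i : ℤ)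

/-- The Maximality condition on a collection of admissible subsets of `J n`:
for every admissible permutation `w` there is a member dominating all members in `≤^w`. -/
def MaximalityCondition {n : ℕ} (ℬ : Set (Finset (J n))) : Prop :=
  ∀ w : Equiv.Perm (J n), IsAdmissiblePerm w → ∃ B ∈ ℬ, ∀ A ∈ ℬ, GaleLE w A B

/-- The symplectic form `⟨(a|b), (c|d)⟩ = a·d − c·b` on `F^{2n}`, coordinates indexed by `J n`. -/
def symplForm {n : ℕ} {F : Type*} [Field F] (u v : J n → F) : F :=
  (∑ i, u (Sum.inl i) * v (Sum.inr i)) - (∑ i, v (Sum.inl i) * u (Sum.inr i))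

/-- A subspace is isotropic if the symplectic form vanishes on every pair of its elements. -/
def IsIsotropic {n : ℕ} {F : Type*} [Field F] (V : Submodule F (J n → F)) : Prop :=
  ∀ u ∈ V, ∀ v ∈ V, symplForm u v = 0

/-- The columns of `M` indexed by `S` are linearly independent. -/
def ColsIndepOn {m : Type*} {n : ℕ} {F : Type*} [Field F]
    (M : Matrix m (J n) F) (S : Finset (J n)) : Prop :=
  LinearIndependent F (fun j : S => fun i => M i (j : J n))

/-- `S` is a basis of the symplectic matroid represented by `M`: an admissible set whose
columns are linearly independent, maximal among admissible sets with this property. -/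
def IsMatroidBasis {m : Type*} {n : ℕ} {F : Type*} [Field F]
    (M : Matrix m (J n) F) (S : Finset (J n)) : Prop :=
  Admissible S ∧ ColsIndepOn M S ∧
    ∀ T : Finset (J n), Admissible T → ColsIndepOn M T → S ⊆ T → S = T

theorem starJ_starJ {n : ℕ} (x : J n) : starJ (starJ x) = x := Sum.swap_swap x

theorem starJ_ne {n : ℕ} (x : J n) : starJ x ≠ x := by
  cases x <;> simp [starJ]

theorem Admissible.insert {n : ℕ} {S : Finset (J n)} (hS : Admissible S) {x : J n}
    (hx : starJ x ∉ S) : Admissible (insert x S) := by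
  intro y hy hy'
  rw [Finset.mem_insert] at hy hy'
  rcases hy with rfl | hy <;> rcases hy' with h | h
  · exact starJ_ne _ h
  · exact hx h
  · exact hx (by rwa [← h, starJ_starJ])
  · exact hS y hy h

theorem colsIndepOn_iff_linearIndepOn {m : Type*} {n : ℕ} {F : Type*} [Field F]
    {M : Matrix m (J n) F} {S : Finset (J n)} :
    ColsIndepOn M S ↔ LinearIndepOn F Mᵀ (S : Set (J n)) := Iff.rfl

theorem ColsIndepOn.card_le {m : Type*} [Fintype m] {n : ℕ} {F : Type*} [Field F]
    {M : Matrix m (J n) F} {S : Finset (J n)} (h : ColsIndepOn M S) :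
    S.card ≤ Fintype.card m := by
  simpa using LinearIndependent.fintype_card_le_finrank h

theorem ColsIndepOn.eq_zero_of_sum_mul_eq_zero {m : Type*} {n : ℕ} {F : Type*} [Field F]
    {M : Matrix m (J n) F} {S : Finset (J n)} (hS : ColsIndepOn M S) {f : J n → F}
    (hf : ∀ i, ∑ j ∈ S, f j * M i j = 0) : ∀ j ∈ S, f j = 0 := by
  intro j hj
  refine Fintype.linearIndependent_iff.mp hS (fun s => f s) ?_ ⟨j, hj⟩
  ext i
  simpa [Finset.sum_apply] using (Finset.sum_coe_sort S fun j => f j * M i j).trans (hf i)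

/-- The sign with which a coordinate of the second argument enters the symplectic form. -/
def symplSign {n : ℕ} (F : Type*) [Field F] : J n → F :=
  Sum.elim (fun _ => -1) (fun _ => 1)

theorem symplSign_ne_zero {n : ℕ} (F : Type*) [Field F] (j : J n) : symplSign F j ≠ 0 := by
  cases j <;> simp [symplSign]

/-- The symplectic form as a single sum over `J n`, with sign `+1` on `[n]*` and `-1` on `[n]`. -/
theorem symplForm_eq_sum {n : ℕ} {F : Type*} [Field F] (u v : J n → F) :
    symplForm u v = ∑ j, (symplSign F j * u (starJ j)) * v j := by
  simp [symplForm, symplSign, starJ, Fintype.sum_sum_type, mul_comm]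
  ring

/-- A vector pairing to zero with every row of `M`, and vanishing on `S` and off `S ∪ S*`,
is zero if the columns of `M` indexed by `S` are linearly independent. -/
theorem ColsIndepOn.eq_zero_of_symplForm_eq_zero {m : Type*} {n : ℕ} {F : Type*} [Field F]
    {M : Matrix m (J n) F} {S : Finset (J n)} (hS : ColsIndepOn M S) {w : J n → F}
    (hw : ∀ i, symplForm w (M i) = 0) (hwS : ∀ j ∈ S, w j = 0)
    (hwT : ∀ j, j ∉ S → starJ j ∉ S → w j = 0) : w = 0 := by
  have hoff : ∀ j, j ∉ S → w (starJ j) = 0 := fun j hj => by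
    by_cases h : starJ j ∈ S
    · exact hwS _ h
    · exact hwT _ h (by rwa [starJ_starJ])
  have hon : ∀ j ∈ S, symplSign F j * w (starJ j) = 0 := hS.eq_zero_of_sum_mul_eq_zero fun i => by
    rw [Finset.sum_subset (Finset.subset_univ S)
      (fun j _ hj => by rw [hoff j hj, mul_zero, zero_mul]), ← symplForm_eq_sum]
    exact hw i
  have hstar : ∀ j, w (starJ j) = 0 := fun j => by
    by_cases hj : j ∈ S
    · exact (mul_eq_zero.mp (hon j hj)).resolve_left (symplSign_ne_zero F j)
    · exact hoff j hj
  ext j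
  simpa [starJ_starJ] using hstar (starJ j)

/-- For `M` with independent rows and isotropic row space, an admissible set of independent
columns with fewer elements than `M` has rows can be enlarged. -/
theorem exists_insert_admissible_colsIndepOn {m : Type*} [Fintype m] {n : ℕ} {F : Type*} [Field F]
    {M : Matrix m (J n) F} (hiso : IsIsotropic (Submodule.span F (Set.range M)))
    (hrows : LinearIndependent F M) {S : Finset (J n)} (hadm : Admissible S)
    (hS : ColsIndepOn M S) (hcard : S.card < Fintype.card m) :
    ∃ x ∉ S, Admissible (insert x S) ∧ ColsIndepOn M (insert x S) := by
  by_contra! hno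
  have hspan : ∀ x, x ∉ S → starJ x ∉ S →
      Mᵀ x ∈ Submodule.span F (Mᵀ '' (S : Set (J n))) := fun x hx hx' => by
    by_contra hmem
    refine hno x hx (hadm.insert hx') ?_
    rw [colsIndepOn_iff_linearIndepOn, Finset.coe_insert]
    exact LinearIndepOn.insert hS hmem
  let f : (m → F) →ₗ[F] (S → F) := (M.submatrix id ((↑) : S → J n)).vecMulLinear
  have hker : LinearMap.ker f ≠ ⊥ := LinearMap.ker_ne_bot_of_finrank_lt (by simpa using hcard)
  obtain ⟨c, hc, hc0⟩ := Submodule.exists_mem_ne_zero_of_ne_bot hker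
  have hwS : ∀ j ∈ S, (c ᵥ* M) j = 0 := fun j hj => congrFun (LinearMap.mem_ker.mp hc) ⟨j, hj⟩
  have hwT : ∀ j, j ∉ S → starJ j ∉ S → (c ᵥ* M) j = 0 := fun j hj hj' => by
    have hle : Submodule.span F (Mᵀ '' (S : Set (J n))) ≤
        LinearMap.ker (dotProductBilin F F c) := by
      rw [Submodule.span_le]
      rintro _ ⟨s, hs, rfl⟩
      exact hwS s hs
    exact hle (hspan j hj hj')
  have hmem : c ᵥ* M ∈ Submodule.span F (Set.range M) := by
    rw [Matrix.vecMul_eq_sum]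
    exact Submodule.sum_mem _ fun i _ =>
      Submodule.smul_mem _ _ (Submodule.subset_span (Set.mem_range_self i))
  have hw : c ᵥ* M = 0 := hS.eq_zero_of_symplForm_eq_zero
    (fun i => hiso _ hmem _ (Submodule.subset_span (Set.mem_range_self i))) hwS hwT
  rw [Matrix.vecMul_eq_sum] at hw
  exact hc0 (funext (Fintype.linearIndependent_iff.mp hrows c hw))

theorem IsMatroidBasis.card_eq {m : Type*} [Fintype m] {n : ℕ} {F : Type*} [Field F]
    {M : Matrix m (J n) F} (hiso : IsIsotropic (Submodule.span F (Set.range M)))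
    (hrows : LinearIndependent F M) {S : Finset (J n)} (hS : IsMatroidBasis M S) :
    S.card = Fintype.card m := by
  obtain ⟨hadm, hind, hmax⟩ := hS
  refine hind.card_le.antisymm (le_of_not_gt fun hlt => ?_)
  obtain ⟨x, hx, hadm', hind'⟩ := exists_insert_admissible_colsIndepOn hiso hrows hadm hind hlt
  exact hx (hmax _ hadm' hind' (Finset.subset_insert x S) ▸ Finset.mem_insert_self x S)

theorem exists_isMatroidBasis {m : Type*} {n : ℕ} {F : Type*} [Field F]
    (M : Matrix m (J n) F) : ∃ S, IsMatroidBasis M S := by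
  have hempty : Admissible (∅ : Finset (J n)) ∧ ColsIndepOn M ∅ :=
    ⟨by simp [Admissible], linearIndependent_empty_type⟩
  obtain ⟨S, hS⟩ := (Set.toFinite {S | Admissible S ∧ ColsIndepOn M S}).exists_maximal ⟨∅, hempty⟩
  exact ⟨S, hS.prop.1, hS.prop.2, fun T hT hT' h => hS.eq_of_le ⟨hT, hT'⟩ h⟩

/-- If `M` is an `(n−k) × 2n` matrix over a finite field with linearly
independent rows and isotropic row space, then some admissible `(n−k)`-subset of `J` indexes
linearly independent columns of `M`; consequently every basis of the symplectic matroid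
represented by `M` has cardinality `n−k`, i.e. the matroid has rank `n−k`. -/
theorem statement1 {n k : ℕ} (hk : k ≤ n) {F : Type*} [Field F] [Fintype F]
    (M : Matrix (Fin (n - k)) (J n) F)
    (hiso : IsIsotropic (Submodule.span F (Set.range M)))
    (hrows : LinearIndependent F M) :
    (∃ S : Finset (J n), Admissible S ∧ S.card = n - k ∧ ColsIndepOn M S) ∧
      ∀ S : Finset (J n), IsMatroidBasis M S → S.card = n - k := by
  have hcard : ∀ S : Finset (J n), IsMatroidBasis M S → S.card = n - k := fun S hS => by
    simpa using hS.card_eq hiso hrows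
  obtain ⟨S, hS⟩ := exists_isMatroidBasis M
  exact ⟨⟨S, hS.1, hcard S hS, hS.2.1⟩, hcard⟩
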